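/- arXiv:0909.2735 — 5 statements merged into one kernel-verified Lean document; each statement's English description precedes it below -/
import Mathlib

section
/- There exists ρ̄ ∈ [0,R) such that ψ is constant (equal to 1) on [0,ρ̄] and ψ is strictly decreasing on [ρ̄,R]. -/
open Set

/-- If `r ↦ r * f r` is concave on `[0, R]` and `f` takes the same value at two points
`0 < a < b`, then `f` is bounded by that value on `(0, a)`. -/
theorem le_of_concaveOn_id_mul {f : ℝ → ℝ} {R a b x : ℝ}
    (hf : ConcaveOn ℝ (Icc 0 R) fun r => r * f r) (hx : 0 < x) (hxa : x < a) (hab : a < b)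
    (hbR : b ≤ R) (h : f a = f b) : f x ≤ f a := by
  have hslope := hf.slope_anti_adjacent (x := x) (y := a) (z := b)
    ⟨hx.le, by linarith⟩ ⟨by linarith, hbR⟩ hxa hab
  have hright : (b * f b - a * f a) / (b - a) = f a := by
    rw [← h, ← sub_mul, mul_div_cancel_left₀ _ (sub_pos.2 hab).ne']
  rw [hright, le_div_iff₀ (sub_pos.2 hxa)] at hslope
  exact le_of_mul_le_mul_left (by linarith) hx

/-- If `f` is continuous at `0`, `r ↦ r * f r` is concave on `[0, R]` and `f` takes the same value
at two points `0 < a < b`, then `f 0` is bounded by that value. -/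
theorem apply_zero_le_of_concaveOn_id_mul {f : ℝ → ℝ} {R a b : ℝ} (hc : ContinuousAt f 0)
    (hf : ConcaveOn ℝ (Icc 0 R) fun r => r * f r) (ha : 0 < a) (hab : a < b)
    (hbR : b ≤ R) (h : f a = f b) : f 0 ≤ f a := by
  refine le_of_tendsto (hc.tendsto.mono_left (nhdsWithin_le_nhds (s := Ioi 0))) ?_
  filter_upwards [Ioo_mem_nhdsGT ha] with x hx
  exact le_of_concaveOn_id_mul hf hx.1 hx.2 hab hbR h

/-- There exists `ρ̄ ∈ [0,R)` such that `ψ` is constant (equal to `1`) on `[0,ρ̄]`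
and `ψ` is strictly decreasing on `[ρ̄,R]`. -/
theorem stmt_0 (R : ℝ) (hR : 0 < R)
    (ψ : ℝ → ℝ) (hψ : ContDiff ℝ 2 ψ)
    (hψmap : ∀ ρ ∈ Set.Icc (0:ℝ) R, ψ ρ ∈ Set.Icc (0:ℝ) 1)
    (hψ0 : ψ 0 = 1) (hψR : ψ R = 0)
    (hψ' : ∀ ρ ∈ Set.Icc (0:ℝ) R, deriv ψ ρ ≤ 0)
    (hψconc : ∀ ρ ∈ Set.Icc (0:ℝ) R, deriv (deriv (fun r => r * ψ r)) ρ ≤ 0) :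
    ∃ ρbar ∈ Set.Ico (0:ℝ) R,
      (∀ ρ ∈ Set.Icc (0:ℝ) ρbar, ψ ρ = 1) ∧
      StrictAntiOn ψ (Set.Icc ρbar R) := by
  have hanti : AntitoneOn ψ (Icc 0 R) :=
    antitoneOn_of_deriv_nonpos (convex_Icc 0 R) hψ.continuous.continuousOn
      (hψ.differentiable (by norm_num)).differentiableOn
      fun x hx => hψ' x (interior_subset hx)
  have hg : ContDiff ℝ 2 fun r => r * ψ r := contDiff_id.mul hψ
  have hconc : ConcaveOn ℝ (Icc 0 R) fun r => r * ψ r := by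
    have hg' : ContDiff ℝ 1 (deriv fun r => r * ψ r) := hg.deriv'
    exact concaveOn_of_deriv2_nonpos (convex_Icc 0 R) hg.continuous.continuousOn
      (hg.differentiable (by norm_num)).differentiableOn
      (hg'.differentiable (by norm_num)).differentiableOn
      fun x hx => hψconc x (interior_subset hx)
  have hcompact : IsCompact (Icc 0 R ∩ ψ ⁻¹' {1}) :=
    isCompact_Icc.inter_right (isClosed_singleton.preimage hψ.continuous)
  obtain ⟨c, ⟨hc, hc1⟩, hmax⟩ := hcompact.exists_isGreatest ⟨0, ⟨le_rfl, hR.le⟩, hψ0⟩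
  have hc1 : ψ c = 1 := hc1
  have hcR : c ≠ R := by
    rintro rfl
    linarith
  refine ⟨c, ⟨hc.1, lt_of_le_of_ne hc.2 hcR⟩, fun x hx => ?_, fun a ha b hb hab => ?_⟩
  · have hxR : x ∈ Icc 0 R := ⟨hx.1, hx.2.trans hc.2⟩
    exact le_antisymm (hψmap x hxR).2 (hc1 ▸ hanti hxR hc hx.2)
  · have haR : a ∈ Icc 0 R := ⟨hc.1.trans ha.1, ha.2⟩
    have hbR : b ∈ Icc 0 R := ⟨hc.1.trans hb.1, hb.2⟩
    refine lt_of_le_of_ne (hanti haR hbR hab.le) fun heq => ?_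
    have hb1 : ψ b ≠ 1 := fun h => (ha.1.trans_lt hab).not_ge (hmax ⟨hbR, h⟩)
    have ha0 : 0 < a := by
      refine lt_of_le_of_ne haR.1 ?_
      rintro rfl
      exact hb1 (heq.trans hψ0)
    have hle := apply_zero_le_of_concaveOn_id_mul hψ.continuous.continuousAt hconc ha0 hab hb.2
      heq.symm
    exact hb1 (le_antisymm (hψmap b hbR).2 (by rw [heq, ← hψ0]; exact hle))
end

section
/- Let (ρ^l,η^l), (ρ^m,η^m), (ρ^r,η^r) be states with densities in (0,R] and ratios η/ρ in [w_min,w_max], such that η^m/ρ^m = η^l/ρ^l (the left and middle states share the Lagrangian marker w), ρ^l ≠ ρ^m, and v(ρ^m,η^m) = v(ρ^r,η^r) =: v̄. Set v^l := v(ρ^l,η^l) and σ := (ρ^m v̄ − ρ^l v^l)/(ρ^m − ρ^l), and assume σ ≤ v̄. Then the piecewise constant function equal to (ρ^l,η^l) for x < σ·t, to (ρ^m,η^m) for σ·t < x < v̄·t, and to (ρ^r,η^r) for x > v̄·t, is a weak solution of the system ∂_t ρ + ∂_x(ρ v(ρ,η)) = 0, ∂_t η + ∂_x(η v(ρ,η))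 = 0 with Riemann initial datum (ρ^l,η^l) for x < 0 and (ρ^r,η^r) for x > 0. (This is the shock-plus-contact-discontinuity solution of the Riemann problem when the left state is in F or C and the right state is in C.) -/
open Set MeasureTheory

/-- The traffic speed `v(ρ,η) = min {V_max, (η/ρ) ψ(ρ)}`. -/
noncomputable def trafficSpeed (Vmax : ℝ) (ψ : ℝ → ℝ) (ρ η : ℝ) : ℝ :=
  min Vmax (η / ρ * ψ ρ)

/-- `(ρ,η)` is a weak solution on `(0,∞) × ℝ` of
`∂_t ρ + ∂_x (ρ v(ρ,η)) = 0`, `∂_t η + ∂_x (η v(ρ,η)) = 0` with initial datum `(ρ₀,η₀)`. -/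
def IsWeakSolution (Vmax : ℝ) (ψ : ℝ → ℝ) (ρ η : ℝ → ℝ → ℝ) (ρ₀ η₀ : ℝ → ℝ) : Prop :=
  ∀ φ : ℝ × ℝ → ℝ, ContDiff ℝ (⊤ : ℕ∞) φ → HasCompactSupport φ →
    ((∫ t in Set.Ioi (0:ℝ), ∫ x : ℝ,
        (ρ t x * fderiv ℝ φ (t, x) (1, 0)
          + ρ t x * trafficSpeed Vmax ψ (ρ t x) (η t x) * fderiv ℝ φ (t, x) (0, 1)))
      + ∫ x : ℝ, ρ₀ x * φ (0, x)) = 0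
    ∧
    ((∫ t in Set.Ioi (0:ℝ), ∫ x : ℝ,
        (η t x * fderiv ℝ φ (t, x) (1, 0)
          + η t x * trafficSpeed Vmax ψ (ρ t x) (η t x) * fderiv ℝ φ (t, x) (0, 1)))
      + ∫ x : ℝ, η₀ x * φ (0, x)) = 0

/-- A bounded measurable weight times a continuous compactly supported function is integrable
on the upper half-plane. -/
lemma integrable_halfPlane_mul {G F : ℝ × ℝ → ℝ} (hG : Measurable G) {C : ℝ}
    (hC : ∀ p, ‖G p‖ ≤ C) (hF : Continuous F) (hFc : HasCompactSupport F) :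
    Integrable (fun p => G p * F p)
      ((volume.restrict (Ioi (0:ℝ))).prod (volume : Measure ℝ)) := by
  have h : Integrable (fun p => G p * F p) (volume.prod volume : Measure (ℝ × ℝ)) :=
    (hF.integrable_of_hasCompactSupport hFc).bdd_mul hG.aestronglyMeasurable
      (Filter.Eventually.of_forall hC)
  have hle : (volume.restrict (Ioi (0:ℝ))).prod (volume : Measure ℝ)
      = (volume.prod volume).restrict (Ioi (0:ℝ) ×ˢ univ) := by
    rw [← Measure.prod_restrict, Measure.restrict_univ]
  rw [hle]
  exact h.restrict

lemma continuous_fderiv_test {φ : ℝ × ℝ → ℝ} (hφ : ContDiff ℝ (⊤ : ℕ∞) φ) (u : ℝ × ℝ) :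
    Continuous fun p => fderiv ℝ φ p u :=
  (hφ.continuous_fderiv (by simp)).clm_apply continuous_const

lemma integrable_transport {φ : ℝ × ℝ → ℝ} (hφ : ContDiff ℝ (⊤ : ℕ∞) φ)
    (hφc : HasCompactSupport φ) (s : ℝ) {g : ℝ → ℝ} (hg : Measurable g) {C : ℝ}
    (hC : ∀ y, ‖g y‖ ≤ C) :
    Integrable (Function.uncurry fun t x => g (x - s * t) * fderiv ℝ φ (t, x) (1, s))
      ((volume.restrict (Ioi (0:ℝ))).prod (volume : Measure ℝ)) :=
  integrable_halfPlane_mul (G := fun p => g (p.2 - s * p.1)) (by fun_prop) (fun _ => hC _)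
    (continuous_fderiv_test hφ _) (hφc.fderiv_apply ℝ (1, s))

/-- A profile `g` transported at constant speed `s` solves `∂_t u + s ∂_x u = 0` weakly. -/
lemma integral_transport {φ : ℝ × ℝ → ℝ} (hφ : ContDiff ℝ (⊤ : ℕ∞) φ)
    (hφc : HasCompactSupport φ) (s : ℝ) {g : ℝ → ℝ} (hg : Measurable g) {C : ℝ}
    (hC : ∀ y, ‖g y‖ ≤ C) :
    ∫ t in Ioi (0:ℝ), ∫ x : ℝ, g (x - s * t) * fderiv ℝ φ (t, x) (1, s)
      = -∫ y : ℝ, g y * φ (0, y) := by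
  have hshift : ∀ t : ℝ, ∫ x : ℝ, g (x - s * t) * fderiv ℝ φ (t, x) (1, s)
      = ∫ y : ℝ, g y * fderiv ℝ φ (t, y + s * t) (1, s) := fun t => by
    rw [← integral_sub_right_eq_self (fun y => g y * fderiv ℝ φ (t, y + s * t) (1, s)) (s * t)]
    simp
  have hcomp : HasCompactSupport fun p : ℝ × ℝ => fderiv ℝ φ (p.1, p.2 + s * p.1) (1, s) := by
    have hK := hφc.fderiv_apply ℝ (1, s)
    refine HasCompactSupport.intro (hK.isCompact.image
      (f := fun p : ℝ × ℝ => (p.1, p.2 - s * p.1)) (by fun_prop)) fun p hp => ?_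
    by_contra h
    exact hp ⟨(p.1, p.2 + s * p.1), subset_tsupport _ h, by simp⟩
  have hint : Integrable
      (Function.uncurry fun t y => g y * fderiv ℝ φ (t, y + s * t) (1, s))
      ((volume.restrict (Ioi (0:ℝ))).prod (volume : Measure ℝ)) :=
    integrable_halfPlane_mul (G := fun p => g p.2) (by fun_prop) (fun _ => hC _)
      ((continuous_fderiv_test hφ (1, s)).comp
        (f := fun p : ℝ × ℝ => (p.1, p.2 + s * p.1)) (by fun_prop)) hcomp
  have hftc : ∀ y : ℝ, ∫ t in Ioi (0:ℝ), fderiv ℝ φ (t, y + s * t) (1, s) = -φ (0, y) := by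
    intro y
    have hd : ∀ t : ℝ, HasDerivAt (fun t : ℝ => φ (t, y + s * t))
        (fderiv ℝ φ (t, y + s * t) (1, s)) t := fun t => by
      have hl : HasDerivAt (fun t : ℝ => (t, y + s * t)) (1, s) t :=
        (hasDerivAt_id t).prodMk (by simpa using ((hasDerivAt_id t).const_mul s).const_add y)
      exact ((hφ.differentiable (by simp) _).hasFDerivAt).comp_hasDerivAt t hl
    have hc : HasCompactSupport fun t : ℝ => φ (t, y + s * t) := by
      refine HasCompactSupport.intro (hφc.isCompact.image continuous_fst) fun t ht => ?_
      by_contra h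
      exact ht ⟨(t, y + s * t), subset_tsupport _ h, rfl⟩
    have hs : ContDiff ℝ 1 fun t : ℝ => φ (t, y + s * t) :=
      (hφ.of_le (by norm_cast)).comp (by fun_prop)
    have := hc.integral_Ioi_deriv_eq hs 0
    simpa [fun t => (hd t).deriv] using this
  simp_rw [hshift]
  rw [integral_integral_swap hint]
  simp_rw [integral_const_mul, hftc, mul_neg, integral_neg]

/-- The weak form of a scalar conservation law for two jumps with speeds `σ ≤ v`, when the
Rankine–Hugoniot condition holds at both. -/
lemma weak_two_jumps {φ : ℝ × ℝ → ℝ} (hφ : ContDiff ℝ (⊤ : ℕ∞) φ)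
    (hφc : HasCompactSupport φ) {σ v : ℝ} (hσv : σ ≤ v) (a b c : ℝ) {U F : ℝ → ℝ → ℝ}
    (hl : ∀ t x, x < σ * t → U t x = a ∧ F t x = b * v + σ * (a - b))
    (hm : ∀ t x, ¬ x < σ * t → x < v * t → U t x = b ∧ F t x = b * v)
    (hr : ∀ t x, ¬ x < σ * t → ¬ x < v * t → U t x = c ∧ F t x = c * v) :
    (∫ t in Ioi (0:ℝ), ∫ x : ℝ,
        (U t x * fderiv ℝ φ (t, x) (1, 0) + F t x * fderiv ℝ φ (t, x) (0, 1)))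
      + ∫ x : ℝ, (if x < 0 then a else c) * φ (0, x) = 0 := by
  have hmeas : ∀ p q : ℝ, Measurable fun y : ℝ => if y < 0 then p else q := fun p q =>
    Measurable.ite measurableSet_Iio measurable_const measurable_const
  have hbdd : ∀ p q y : ℝ, ‖if y < 0 then p else q‖ ≤ |p| + |q| := fun p q y => by
    split_ifs <;> simp
  have hsplit : ∀ t ∈ Ioi (0:ℝ), (∫ x : ℝ,
        (U t x * fderiv ℝ φ (t, x) (1, 0) + F t x * fderiv ℝ φ (t, x) (0, 1)))
      = ∫ x : ℝ, ((if x - v * t < 0 then b else c) * fderiv ℝ φ (t, x) (1, v)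
        + (if x - σ * t < 0 then a - b else 0) * fderiv ℝ φ (t, x) (1, σ)) := by
    intro t ht
    have hst : σ * t ≤ v * t := mul_le_mul_of_nonneg_right hσv (le_of_lt ht)
    congr 1 with x
    have hd : ∀ s : ℝ, fderiv ℝ φ (t, x) (1, s)
        = fderiv ℝ φ (t, x) (1, 0) + s * fderiv ℝ φ (t, x) (0, 1) := fun s => by
      rw [← smul_eq_mul, ← map_smul, ← map_add]; simp
    rw [hd v, hd σ]
    simp only [sub_neg]
    by_cases h1 : x < σ * t
    · rw [(hl t x h1).1, (hl t x h1).2, if_pos h1, if_pos (h1.trans_le hst)]; ring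
    · by_cases h2 : x < v * t
      · rw [(hm t x h1 h2).1, (hm t x h1 h2).2, if_neg h1, if_pos h2]; ring
      · rw [(hr t x h1 h2).1, (hr t x h1 h2).2, if_neg h1, if_neg h2]; ring
  have hinit : ∀ p q : ℝ, Integrable fun y : ℝ => (if y < 0 then p else q) * φ (0, y) := by
    intro p q
    refine Integrable.bdd_mul (c := |p| + |q|) (Continuous.integrable_of_hasCompactSupport
      (hφ.continuous.comp (by fun_prop)) ?_) (hmeas p q).aestronglyMeasurable
      (Filter.Eventually.of_forall (hbdd p q))
    refine HasCompactSupport.intro (hφc.isCompact.image continuous_snd) fun y hy => ?_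
    by_contra h
    exact hy ⟨(0, y), subset_tsupport _ h, rfl⟩
  have hadd := integral_integral_add (integrable_transport hφ hφc v (hmeas b c) (hbdd b c))
    (integrable_transport hφ hφc σ (hmeas (a - b) 0) (hbdd (a - b) 0))
  simp only [Function.uncurry_apply_pair] at hadd
  rw [setIntegral_congr_fun measurableSet_Ioi hsplit, hadd,
    integral_transport hφ hφc v (hmeas b c) (hbdd b c),
    integral_transport hφ hφc σ (hmeas (a - b) 0) (hbdd (a - b) 0), ← neg_add,
    ← integral_add (hinit _ _) (hinit _ _), neg_add_eq_zero]
  congr 1 with y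
  split_ifs <;> ring

/-- The shock (at the Rankine–Hugoniot speed `σ`) followed by a contact discontinuity
(at the common speed `v̄` of the middle and right states) is a weak solution of the
Riemann problem with data `(ρ^l,η^l)`, `(ρ^r,η^r)`. -/
theorem stmt_8 (R wmin wmax Vmax : ℝ)
    (hR : 0 < R) (hwmin : 0 < wmin) (hwmax : 0 < wmax) (hVmax : 0 < Vmax)
    (hww : wmin < wmax) (hVw : Vmax < wmin)
    (ψ : ℝ → ℝ) (hψ : ContDiff ℝ 2 ψ)
    (hψmap : ∀ ρ ∈ Set.Icc (0:ℝ) R, ψ ρ ∈ Set.Icc (0:ℝ) 1)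
    (hψ0 : ψ 0 = 1) (hψR : ψ R = 0)
    (hψ' : ∀ ρ ∈ Set.Icc (0:ℝ) R, deriv ψ ρ ≤ 0)
    (hψconc : ∀ ρ ∈ Set.Icc (0:ℝ) R, deriv (deriv (fun r => r * ψ r)) ρ ≤ 0)
    (ρl ηl ρm ηm ρr ηr vl vbar σ : ℝ)
    (hρl : ρl ∈ Set.Ioc (0:ℝ) R) (hρm : ρm ∈ Set.Ioc (0:ℝ) R) (hρr : ρr ∈ Set.Ioc (0:ℝ) R)
    (hwl : ηl / ρl ∈ Set.Icc wmin wmax) (hwm : ηm / ρm ∈ Set.Icc wmin wmax)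
    (hwr : ηr / ρr ∈ Set.Icc wmin wmax)
    (hw : ηm / ρm = ηl / ρl) (hne : ρl ≠ ρm)
    (hvm : trafficSpeed Vmax ψ ρm ηm = vbar)
    (hvr : trafficSpeed Vmax ψ ρr ηr = vbar)
    (hvl : trafficSpeed Vmax ψ ρl ηl = vl)
    (hσ : σ = (ρm * vbar - ρl * vl) / (ρm - ρl))
    (hσv : σ ≤ vbar) :
    IsWeakSolution Vmax ψ
      (fun t x => if x < σ * t then ρl else if x < vbar * t then ρm else ρr)
      (fun t x => if x < σ * t then ηl else if x < vbar * t then ηm else ηr)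
      (fun x => if x < 0 then ρl else ρr)
      (fun x => if x < 0 then ηl else ηr) := by
  have hl0 : ρl ≠ 0 := hρl.1.ne'
  have hm0 : ρm ≠ 0 := hρm.1.ne'
  have hd : ρm - ρl ≠ 0 := sub_ne_zero.mpr hne.symm
  have hRH : ρl * vl = ρm * vbar + σ * (ρl - ρm) := by
    have := (eq_div_iff hd).mp hσ
    linarith
  have hηl : ηl = ηl / ρl * ρl := (div_mul_cancel₀ ηl hl0).symm
  have hηm : ηm = ηl / ρl * ρm := by rw [← hw, div_mul_cancel₀ ηm hm0]
  have hRHη : ηl * vl = ηm * vbar + σ * (ηl - ηm) := by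
    generalize ηl / ρl = w at hηl hηm
    subst hηl hηm
    linear_combination w * hRH
  intro φ hφ hφc
  refine ⟨weak_two_jumps hφ hφc hσv ρl ρm ρr ?_ ?_ ?_,
    weak_two_jumps hφ hφc hσv ηl ηm ηr ?_ ?_ ?_⟩
  · intro t x h
    simp [h, hvl, hRH]
  · intro t x h h'
    simp only [if_neg h, if_pos h', hvm, and_self]
  · intro t x h h'
    simp only [if_neg h, if_neg h', hvr, and_self]
  · intro t x h
    simp [h, hvl, hRHη]
  · intro t x h h'
    simp only [if_neg h, if_pos h', hvm, and_self]
  · intro t x h h'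
    simp only [if_neg h, if_neg h', hvr, and_self]
end

section
/- Let w ∈ [w_min,w_max] and let ρ^l, ρ^m ∈ (0,R] be such that w ψ(ρ^l) ≥ V_max (so the left state (ρ^l, wρ^l) is in the free phase, with speed v^l = V_max) and w ψ(ρ^m) < V_max (so the middle state (ρ^m, wρ^m) is in the congested phase, with speed v^m = w ψ(ρ^m)). Then ρ^m > ρ^l, and the Rankine–Hugoniot speed σ := (ρ^m v^m − ρ^l V_max)/(ρ^m − ρ^l) of the phase-boundary shock satisfies σ < v^m; in particular the shock travels strictly slower than the downstream traffic speed, so information is carried no faster than vehicles. -/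
open Set

/-- If the left state `(ρ^l, wρ^l)` is free (`w ψ(ρ^l) ≥ V_max`) and the middle state
`(ρ^m, wρ^m)` is congested (`w ψ(ρ^m) < V_max`), then `ρ^m > ρ^l` and the
Rankine–Hugoniot speed `σ = (ρ^m v^m − ρ^l V_max)/(ρ^m − ρ^l)` of the phase-boundary
shock is strictly smaller than the downstream traffic speed `v^m = w ψ(ρ^m)`. -/
theorem stmt_9 (R wmin wmax Vmax : ℝ)
    (hR : 0 < R) (hwmin : 0 < wmin) (hwmax : 0 < wmax) (hVmax : 0 < Vmax)
    (hww : wmin < wmax) (hVw : Vmax < wmin)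
    (ψ : ℝ → ℝ) (hψ : ContDiff ℝ 2 ψ)
    (hψmap : ∀ ρ ∈ Set.Icc (0:ℝ) R, ψ ρ ∈ Set.Icc (0:ℝ) 1)
    (hψ0 : ψ 0 = 1) (hψR : ψ R = 0)
    (hψ' : ∀ ρ ∈ Set.Icc (0:ℝ) R, deriv ψ ρ ≤ 0)
    (hψconc : ∀ ρ ∈ Set.Icc (0:ℝ) R, deriv (deriv (fun r => r * ψ r)) ρ ≤ 0)
    (w ρl ρm : ℝ) (hw : w ∈ Set.Icc wmin wmax)
    (hρl : ρl ∈ Set.Ioc (0:ℝ) R) (hρm : ρm ∈ Set.Ioc (0:ℝ) R)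
    (hfree : Vmax ≤ w * ψ ρl) (hcong : w * ψ ρm < Vmax) :
    ρl < ρm ∧
    (ρm * (w * ψ ρm) - ρl * Vmax) / (ρm - ρl) < w * ψ ρm := by
  have hanti : AntitoneOn ψ (Icc 0 R) :=
    antitoneOn_of_deriv_nonpos (convex_Icc 0 R) hψ.continuous.continuousOn
      (hψ.differentiable two_ne_zero).differentiableOn
      fun ρ hρ => hψ' ρ (interior_subset hρ)
  have hwpos : 0 < w := hwmin.trans_le hw.1
  have hψlt : ψ ρm < ψ ρl := lt_of_mul_lt_mul_left (hcong.trans_le hfree) hwpos.le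
  have hlt : ρl < ρm :=
    hanti.reflect_lt (Ioc_subset_Icc_self hρm) (Ioc_subset_Icc_self hρl) hψlt
  refine ⟨hlt, ?_⟩
  rw [div_lt_iff₀ (sub_pos.mpr hlt)]
  linarith [mul_lt_mul_of_pos_left hcong hρl.1]
end

section
/- Fix n ∈ ℕ with n ≥ 2, l > 0, maximal speeds w_1, …, w_n ∈ [w_min, w_max], and initial positions p̃_1 < … < p̃_{n+1} with p̃_{i+1} − p̃_i ≥ l for i = 1, …, n. Then the Follow-The-Leader system ṗ_i(t) = min{V_max, w_i ψ(l/(p_{i+1}(t) − p_i(t)))} for i = 1, …, n, ṗ_{n+1}(t) = V_max, with p_i(0) = p̃_i for i = 1, …, n+1, admits a unique continuously differentiable solution (p_1, …, p_{n+1}) defined for all t ≥ 0, and this solution satisfies p_{i+1}(t) − p_i(t) ≥ l for all t ≥ 0 and all i = 1, …, n. -/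
open Set

/-- `p` solves the Follow-The-Leader system
`ṗ_i = min {V_max, w_i ψ(l/(p_{i+1} − p_i))}` for `i = 1, …, n`, `ṗ_{n+1} = V_max`,
with initial positions `p0`, for all times `t ≥ 0`. -/
def IsFTLSolution (Vmax l : ℝ) (ψ : ℝ → ℝ) (n : ℕ) (w : Fin n → ℝ)
    (p0 : Fin (n + 1) → ℝ) (p : Fin (n + 1) → ℝ → ℝ) : Prop :=
  (∀ i : Fin (n + 1), p i 0 = p0 i) ∧
  ∀ t ∈ Set.Ici (0:ℝ),
    (∀ i : Fin n,
      HasDerivWithinAt (p i.castSucc)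
        (min Vmax (w i * ψ (l / (p i.succ t - p i.castSucc t))))
        (Set.Ici (0:ℝ)) t) ∧
    HasDerivWithinAt (p (Fin.last n)) Vmax (Set.Ici (0:ℝ)) t

open scoped NNReal Topology

/-- Global forward existence for a bounded, globally Lipschitz vector field. -/
theorem exists_forall_nonneg_hasDerivWithinAt {E : Type*} [NormedAddCommGroup E]
    [NormedSpace ℝ E] [CompleteSpace E] {v : ℝ → E → E} {K L : ℝ≥0} (x₀ : E)
    (hlip : ∀ t, 0 ≤ t → LipschitzWith K (v t))
    (hcont : ∀ x, ContinuousOn (fun t => v t x) (Ici 0))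
    (hbound : ∀ t, 0 ≤ t → ∀ x, ‖v t x‖ ≤ L) :
    ∃ x : ℝ → E, x 0 = x₀ ∧ ∀ t, 0 ≤ t → HasDerivWithinAt x (v t (x t)) (Ici 0) t := by
  have hloc : ∀ N : ℕ, ∃ α : ℝ → E, α 0 = x₀ ∧
      ∀ t ∈ Icc (0 : ℝ) N, HasDerivWithinAt α (v t (α t)) (Icc 0 N) t := by
    intro N
    have hpl : IsPicardLindelof v (tmin := 0) (tmax := N) ⟨0, le_rfl, N.cast_nonneg⟩ x₀
        (L * N) 0 L K :=
      { lipschitzOnWith := fun t ht => (hlip t ht.1).lipschitzOnWith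
        continuousOn := fun x _ => (hcont x).mono Icc_subset_Ici_self
        norm_le := fun t ht x _ => hbound t ht.1 x
        mul_max_le := by simp }
    exact hpl.exists_eq_forall_mem_Icc_hasDerivWithinAt₀
  choose α hα0 hα using hloc
  have hagree : ∀ N M : ℕ, N ≤ M → EqOn (α N) (α M) (Icc 0 N) := by
    intro N M hNM
    have hsub : Icc (0 : ℝ) N ⊆ Icc 0 M := Icc_subset_Icc_right (by exact_mod_cast hNM)
    have hright : ∀ k : ℕ, ∀ t ∈ Ico (0 : ℝ) k, HasDerivWithinAt (α k) (v t (α k t)) (Ici t) t :=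
      fun k t ht => (hα k t (Ico_subset_Icc_self ht)).mono_of_mem_nhdsWithin
        (Filter.mem_of_superset (Icc_mem_nhdsGE ht.2) (Icc_subset_Icc_left ht.1))
    refine ODE_solution_unique_of_mem_Icc_right (v := v) (s := fun _ => univ) (K := K)
      (fun t ht => (hlip t ht.1).lipschitzOnWith)
      (fun t ht => (hα N t ht).continuousWithinAt) (hright N) (fun _ _ => mem_univ _)
      (fun t ht => ((hα M t (hsub ht)).mono hsub).continuousWithinAt)
      (fun t ht => hright M t ⟨ht.1, ht.2.trans_le (by exact_mod_cast hNM)⟩)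
      (fun _ _ => mem_univ _) (by rw [hα0, hα0])
  have heq : ∀ N : ℕ, ∀ s : ℝ, 0 ≤ s → s < N → α (⌊s⌋₊ + 1) s = α N s := by
    intro N s hs hsN
    refine hagree _ N (Nat.succ_le_of_lt ((Nat.floor_lt hs).2 hsN)) ⟨hs, ?_⟩
    push_cast
    exact (Nat.lt_floor_add_one s).le
  refine ⟨fun t => α (⌊t⌋₊ + 1) t, by simp [hα0], fun t ht => ?_⟩
  have htN : t < ((⌊t⌋₊ + 1 : ℕ) : ℝ) := by
    push_cast
    exact Nat.lt_floor_add_one t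
  have hnhds : Icc (0 : ℝ) ((⌊t⌋₊ + 1 : ℕ) : ℝ) ∈ 𝓝[Ici 0] t := by
    rw [← Ici_inter_Iic]
    exact Filter.inter_mem self_mem_nhdsWithin (mem_nhdsWithin_of_mem_nhds (Iic_mem_nhds htN))
  refine ((hα _ t ⟨ht, htN.le⟩).mono_of_mem_nhdsWithin hnhds).congr_of_eventuallyEq ?_ rfl
  filter_upwards [self_mem_nhdsWithin, mem_nhdsWithin_of_mem_nhds (Iio_mem_nhds htN)]
    with s hs hsN
  exact heq _ s hs hsN

/-- A follower whose speed vanishes as soon as the gap to a leader moving forwards is at most `l`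
keeps a gap of at least `l`. -/
theorem le_gap_of_speed_eq_zero {F P x : ℝ → ℝ} {l : ℝ} (hF : ∀ g ≤ l, F g = 0)
    (hP : ∀ t, 0 ≤ t → ∃ u, 0 ≤ u ∧ HasDerivWithinAt P u (Ici 0) t)
    (hx : ∀ t, 0 ≤ t → HasDerivWithinAt x (F (P t - x t)) (Ici 0) t)
    (h0 : l ≤ P 0 - x 0) {t : ℝ} (ht : 0 ≤ t) : l ≤ P t - x t := by
  choose! u hu hPu using hP
  have hder : ∀ s, 0 ≤ s →
      HasDerivWithinAt (fun s => l - (P s - x s)) (-(u s - F (P s - x s))) (Ici 0) s :=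
    fun s hs => ((hPu s hs).sub (hx s hs)).const_sub l
  refine le_of_forall_pos_le_add fun ε hε => ?_
  have hδ : 0 < ε / (t + 1) := by positivity
  have key := image_le_of_deriv_right_lt_deriv_boundary (a := 0) (b := t)
    (f := fun s => l - (P s - x s)) (f' := fun s => -(u s - F (P s - x s)))
    (B := fun s => ε / (t + 1) * s) (B' := fun _ => ε / (t + 1))
    (fun s hs => (hder s hs.1).continuousWithinAt.mono Icc_subset_Ici_self)
    (fun s hs => (hder s hs.1).mono (Ici_subset_Ici.2 hs.1))
    (by simpa using h0)
    (fun s => by simpa using (hasDerivAt_id s).const_mul (ε / (t + 1)))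
    (fun s hs hfs => by
      have hge : 0 ≤ ε / (t + 1) * s := mul_nonneg hδ.le hs.1
      have hz := hF (P s - x s) (by linarith)
      have := hu s hs.1
      simp only [hz]
      linarith)
    (right_mem_Icc.2 ht)
  have hle : ε / (t + 1) * t ≤ ε := by
    rw [div_mul_eq_mul_div, div_le_iff₀ (by positivity)]
    nlinarith
  linarith

/-- Uniqueness of the follower's trajectory when the speed law is Lipschitz on gaps `≥ c` and one
solution has gaps staying strictly above `c`. -/
theorem follower_unique {F P x y : ℝ → ℝ} {c l : ℝ} {K : ℝ≥0} (hcl : c < l)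
    (hF : LipschitzOnWith K F (Ici c)) (hP : ContinuousOn P (Ici 0))
    (hx : ∀ t, 0 ≤ t → HasDerivWithinAt x (F (P t - x t)) (Ici 0) t)
    (hy : ∀ t, 0 ≤ t → HasDerivWithinAt y (F (P t - y t)) (Ici 0) t)
    (hgap : ∀ t, 0 ≤ t → l ≤ P t - x t) (h0 : y 0 = x 0) {t : ℝ} (ht : 0 ≤ t) :
    y t = x t := by
  have hxc : ContinuousOn x (Ici 0) := fun s hs => (hx s hs).continuousWithinAt
  have hyc : ContinuousOn y (Ici 0) := fun s hs => (hy s hs).continuousWithinAt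
  have hclosed : IsClosed ({s | y s = x s} ∩ Icc 0 t) := by
    have : {s | y s = x s} ∩ Icc 0 t = Icc 0 t ∩ (fun s => y s - x s) ⁻¹' {0} := by
      ext s
      simp [sub_eq_zero, and_comm]
    rw [this]
    exact ((hyc.sub hxc).mono Icc_subset_Ici_self).preimage_isClosed_of_isClosed isClosed_Icc
      isClosed_singleton
  refine hclosed.Icc_subset_of_forall_mem_nhdsWithin h0 ?_ (right_mem_Icc.2 ht)
  rintro s ⟨hs, hs0, -⟩
  have hsub : Ici s ⊆ Ici (0 : ℝ) := Ici_subset_Ici.2 hs0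
  have hgapy : ∀ᶠ r in 𝓝[≥] s, c < P r - y r := by
    refine ((hP.sub hyc) s hs0 |>.mono hsub).eventually (lt_mem_nhds ?_)
    have : y s = x s := hs
    simpa only [this, Pi.sub_apply] using hcl.trans_le (hgap s hs0)
  obtain ⟨b, hsb, hb⟩ := (mem_nhdsGE_iff_exists_Icc_subset).1 hgapy
  have hsubI : Icc s b ⊆ Ici (0 : ℝ) := Icc_subset_Ici_self.trans hsub
  have hEq : EqOn y x (Icc s b) := by
    refine ODE_solution_unique_of_mem_Icc_right (v := fun r z => F (P r - z))
      (s := fun r => {z | c ≤ P r - z}) (K := K) ?_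
      (hyc.mono hsubI)
      (fun r hr => (hy r (hs0.trans hr.1)).mono (Ici_subset_Ici.2 (hs0.trans hr.1)))
      (fun r hr => (show c < P r - y r from hb (Ico_subset_Icc_self hr)).le)
      (hxc.mono hsubI)
      (fun r hr => (hx r (hs0.trans hr.1)).mono (Ici_subset_Ici.2 (hs0.trans hr.1)))
      (fun r hr => hcl.le.trans (hgap r (hs0.trans hr.1))) hs
    refine fun r _ => LipschitzOnWith.of_dist_le_mul fun z hz z' hz' => ?_
    simpa only [dist_sub_left] using hF.dist_le_mul _ hz _ hz'
  exact Filter.mem_of_superset (Icc_mem_nhdsGT hsb) hEq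

/-- Existence, safety and uniqueness of the trajectory of one follower behind a given leader. -/
theorem exists_unique_follower {F P : ℝ → ℝ} {c l x₀ : ℝ} {K L : ℝ≥0} (hcl : c < l)
    (hF : LipschitzOnWith K F (Ici c)) (hFl : F l = 0) (hFL : ∀ g, l ≤ g → |F g| ≤ L)
    (hP : ∀ t, 0 ≤ t → ∃ u, 0 ≤ u ∧ HasDerivWithinAt P u (Ici 0) t)
    (h0 : l ≤ P 0 - x₀) :
    ∃ x : ℝ → ℝ, x 0 = x₀ ∧
      (∀ t, 0 ≤ t → HasDerivWithinAt x (F (P t - x t)) (Ici 0) t) ∧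
      (∀ t, 0 ≤ t → l ≤ P t - x t) ∧
      ∀ y : ℝ → ℝ, y 0 = x₀ →
        (∀ t, 0 ≤ t → HasDerivWithinAt y (F (P t - y t)) (Ici 0) t) →
        ∀ t, 0 ≤ t → y t = x t := by
  have hPc : ContinuousOn P (Ici 0) := fun t ht =>
    let ⟨_, _, h⟩ := hP t ht
    h.continuousWithinAt
  have hG : LipschitzWith K (fun g => F (max g l)) := by
    have := hF.comp (f := fun g => max g l) (s := univ)
      (LipschitzWith.id.max_const l).lipschitzOnWith
      (fun g _ => hcl.le.trans (le_max_right g l))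
    simpa [Function.comp_def] using this
  obtain ⟨x, hx0, hx⟩ := exists_forall_nonneg_hasDerivWithinAt
    (v := fun t z => F (max (P t - z) l)) (K := K) (L := L) x₀
    (fun t _ => LipschitzWith.of_dist_le_mul fun z z' => by
      simpa only [dist_sub_left] using hG.dist_le_mul (P t - z) (P t - z'))
    (fun z => hG.continuous.comp_continuousOn (hPc.sub continuousOn_const))
    (fun t _ z => hFL _ (le_max_right _ _))
  have hgap : ∀ t, 0 ≤ t → l ≤ P t - x t := fun t ht =>
    le_gap_of_speed_eq_zero (F := fun g => F (max g l))
      (fun g hg => by simp only [max_eq_right hg, hFl]) hP hx (by rwa [hx0]) ht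
  have hx' : ∀ t, 0 ≤ t → HasDerivWithinAt x (F (P t - x t)) (Ici 0) t := fun t ht => by
    simpa only [max_eq_left (hgap t ht)] using hx t ht
  exact ⟨x, hx0, hx', hgap, fun y hy0 hy t ht =>
    follower_unique hcl hF hPc hx' hy hgap (hy0.trans hx0.symm) ht⟩

/-- The speed law, as a function of the gap, is Lipschitz on gaps bounded away from zero. -/
theorem exists_lipschitzOnWith_speed {ψ : ℝ → ℝ} (hψ : ContDiff ℝ 1 ψ) {l : ℝ} (hl : 0 < l)
    (V w : ℝ) : ∃ K, LipschitzOnWith K (fun g => min V (w * ψ (l / g))) (Ici (l / 2)) := by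
  have hψw : ContDiff ℝ 1 (fun r => w * ψ r) := contDiff_const.mul hψ
  obtain ⟨K, hK⟩ := (hψw.locallyLipschitz.const_min V).locallyLipschitzOn
    (s := Icc 0 2) |>.exists_lipschitzOnWith_of_compact isCompact_Icc
  have hdiv : LipschitzOnWith (4 / l).toNNReal (fun g => l / g) (Ici (l / 2)) := by
    refine LipschitzOnWith.of_dist_le_mul fun a ha b hb => ?_
    rw [mem_Ici] at ha hb
    have ha0 : 0 < a := by linarith
    have hb0 : 0 < b := by linarith
    rw [Real.coe_toNNReal _ (by positivity), Real.dist_eq, Real.dist_eq,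
      show l / a - l / b = l / (a * b) * (b - a) by field_simp, abs_mul, abs_sub_comm b a,
      abs_of_pos (by positivity)]
    refine mul_le_mul_of_nonneg_right ?_ (abs_nonneg _)
    rw [div_le_div_iff₀ (by positivity) hl]
    nlinarith [mul_le_mul ha hb (by positivity) ha0.le]
  refine ⟨_, hK.comp hdiv fun g hg => ?_⟩
  rw [mem_Ici] at hg
  have hg0 : 0 < g := by linarith
  exact ⟨by positivity, by rw [div_le_iff₀ hg0]; linarith⟩

theorem IsFTLSolution.tail {V l : ℝ} {ψ : ℝ → ℝ} {n : ℕ} {w : Fin (n + 1) → ℝ}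
    {p0 : Fin (n + 2) → ℝ} {p : Fin (n + 2) → ℝ → ℝ}
    (hp : IsFTLSolution V l ψ (n + 1) w p0 p) :
    IsFTLSolution V l ψ n (fun i => w i.succ) (fun i => p0 i.succ) (fun i => p i.succ) :=
  ⟨fun i => hp.1 i.succ, fun t ht => ⟨fun i => (hp.2 t ht).1 i.succ, (hp.2 t ht).2⟩⟩

theorem IsFTLSolution.cons {V l : ℝ} {ψ : ℝ → ℝ} {n : ℕ} {w : Fin (n + 1) → ℝ}
    {p0 : Fin (n + 2) → ℝ} {x : ℝ → ℝ} {p : Fin (n + 1) → ℝ → ℝ}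
    (hp : IsFTLSolution V l ψ n (fun i => w i.succ) (fun i => p0 i.succ) p)
    (hx0 : x 0 = p0 0)
    (hx : ∀ t, 0 ≤ t →
      HasDerivWithinAt x (min V (w 0 * ψ (l / (p 0 t - x t)))) (Ici 0) t) :
    IsFTLSolution V l ψ (n + 1) w p0 (Fin.cons x p : Fin (n + 2) → ℝ → ℝ) := by
  refine ⟨fun i => ?_, fun t ht => ⟨fun i => ?_, (hp.2 t ht).2⟩⟩
  · cases i using Fin.cases with
    | zero => exact hx0
    | succ j => exact hp.1 j
  · cases i using Fin.cases with
    | zero => exact hx t ht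
    | succ j => exact (hp.2 t ht).1 j

theorem IsFTLSolution.exists_nonneg_deriv {V l : ℝ} {ψ : ℝ → ℝ} {n : ℕ} {w : Fin n → ℝ}
    {p0 : Fin (n + 1) → ℝ} {p : Fin (n + 1) → ℝ → ℝ}
    (hp : IsFTLSolution V l ψ n w p0 p) (hV : 0 ≤ V) (hl : 0 < l)
    (hψ : ∀ ρ ∈ Icc (0 : ℝ) 1, 0 ≤ ψ ρ) (hw : ∀ i, 0 ≤ w i)
    (hgap : ∀ t, 0 ≤ t → ∀ i : Fin n, l ≤ p i.succ t - p i.castSucc t)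
    (i : Fin (n + 1)) (t : ℝ) (ht : 0 ≤ t) :
    ∃ u, 0 ≤ u ∧ HasDerivWithinAt (p i) u (Ici 0) t := by
  cases i using Fin.lastCases with
  | last => exact ⟨V, hV, (hp.2 t ht).2⟩
  | cast j =>
    refine ⟨_, le_min hV (mul_nonneg (hw j) (hψ _ ?_)), (hp.2 t ht).1 j⟩
    have hg := hgap t ht j
    exact ⟨div_nonneg hl.le (hl.le.trans hg), div_le_one_of_le₀ hg (hl.le.trans hg)⟩

/-- Well-posedness of the Follow-The-Leader system for any number of followers. -/
theorem exists_unique_isFTLSolution {V l : ℝ} {ψ : ℝ → ℝ} (hV : 0 ≤ V) (hl : 0 < l)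
    (hψ : ContDiff ℝ 1 ψ) (hψ0 : ∀ ρ ∈ Icc (0 : ℝ) 1, 0 ≤ ψ ρ) (hψ1 : ψ 1 = 0)
    (n : ℕ) (w : Fin n → ℝ) (hw : ∀ i, 0 ≤ w i) (p0 : Fin (n + 1) → ℝ)
    (hp0 : ∀ i : Fin n, l ≤ p0 i.succ - p0 i.castSucc) :
    ∃ p : Fin (n + 1) → ℝ → ℝ, IsFTLSolution V l ψ n w p0 p ∧
      (∀ t, 0 ≤ t → ∀ i : Fin n, l ≤ p i.succ t - p i.castSucc t) ∧
      ∀ q : Fin (n + 1) → ℝ → ℝ, IsFTLSolution V l ψ n w p0 q →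
        ∀ i, ∀ t, 0 ≤ t → q i t = p i t := by
  induction n with
  | zero =>
    have hder : ∀ t, HasDerivAt (fun t => p0 0 + V * t) V t := fun t => by
      simpa using ((hasDerivAt_id t).const_mul V).const_add (p0 0)
    refine ⟨fun _ t => p0 0 + V * t, ⟨fun i => ?_, fun t _ => ⟨fun i => i.elim0,
      (hder t).hasDerivWithinAt⟩⟩, fun _ _ i => i.elim0, fun q hq i t ht => ?_⟩
    · obtain rfl : i = 0 := Fin.fin_one_eq_zero i
      simp
    · obtain rfl : i = Fin.last 0 := Fin.fin_one_eq_zero i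
      refine ODE_solution_unique_of_mem_Icc_right (v := fun _ _ => V) (s := fun _ => univ)
        (K := 0) (a := 0) (b := t) (fun _ _ => (LipschitzWith.const V).lipschitzOnWith)
        (fun s hs => ((hq.2 s hs.1).2.mono Icc_subset_Ici_self).continuousWithinAt)
        (fun s hs => (hq.2 s hs.1).2.mono (Ici_subset_Ici.2 hs.1)) (fun _ _ => mem_univ _)
        (fun s _ => (hder s).continuousAt.continuousWithinAt)
        (fun s _ => (hder s).hasDerivWithinAt) (fun _ _ => mem_univ _) ?_ (right_mem_Icc.2 ht)
      simpa using hq.1 (Fin.last 0)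
  | succ n ih =>
    obtain ⟨p, hp, hgap, huniq⟩ := ih (fun i => w i.succ) (fun i => hw i.succ)
      (fun i => p0 i.succ) (fun i => hp0 i.succ)
    obtain ⟨K, hK⟩ := exists_lipschitzOnWith_speed hψ hl V (w 0)
    obtain ⟨x, hx0, hx, hxgap, hxuniq⟩ := exists_unique_follower (P := p 0) (x₀ := p0 0)
      (L := V.toNNReal) (half_lt_self hl) hK (by simp [div_self hl.ne', hψ1, hV])
      (fun g hg => by
        have hg0 : 0 ≤ g := hl.le.trans hg
        rw [Real.coe_toNNReal V hV, abs_of_nonneg (le_min hV (mul_nonneg (hw 0)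
          (hψ0 _ ⟨div_nonneg hl.le hg0, div_le_one_of_le₀ hg hg0⟩)))]
        exact min_le_left _ _)
      (hp.exists_nonneg_deriv hV hl hψ0 (fun i => hw i.succ) hgap 0)
      (by rw [hp.1 0]; exact hp0 0)
    refine ⟨Fin.cons x p, hp.cons hx0 hx, fun t ht i => ?_, fun q hq i t ht => ?_⟩
    · cases i using Fin.cases with
      | zero => exact hxgap t ht
      | succ j => exact hgap t ht j
    · have htail := huniq _ hq.tail
      cases i using Fin.cases with
      | succ j => exact htail j t ht
      | zero =>
        refine hxuniq (q 0) (hq.1 0) (fun s hs => ?_) t ht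
        rw [← htail 0 s hs]
        exact (hq.2 s hs).1 0

/-- The Follow-The-Leader system with initial spacings `≥ l` admits a unique
(continuously differentiable) solution defined for all `t ≥ 0`, and this solution
keeps all spacings `≥ l` for all `t ≥ 0`. -/
theorem stmt_13 (wmin wmax Vmax : ℝ)
    (hwmin : 0 < wmin) (hwmax : 0 < wmax) (hVmax : 0 < Vmax)
    (hww : wmin < wmax) (hVw : Vmax < wmin)
    (ψ : ℝ → ℝ) (hψ : ContDiff ℝ 2 ψ)
    (hψmap : ∀ ρ ∈ Set.Icc (0:ℝ) 1, ψ ρ ∈ Set.Icc (0:ℝ) 1)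
    (hψ0 : ψ 0 = 1) (hψ1 : ψ 1 = 0)
    (hψ' : ∀ ρ ∈ Set.Icc (0:ℝ) 1, deriv ψ ρ ≤ 0)
    (hψconc : ∀ ρ ∈ Set.Icc (0:ℝ) 1, deriv (deriv (fun r => r * ψ r)) ρ ≤ 0)
    (n : ℕ) (hn : 2 ≤ n) (l : ℝ) (hl : 0 < l)
    (w : Fin n → ℝ) (hw : ∀ i, w i ∈ Set.Icc wmin wmax)
    (p0 : Fin (n + 1) → ℝ)
    (hp0mono : StrictMono p0)
    (hp0 : ∀ i : Fin n, l ≤ p0 i.succ - p0 i.castSucc) :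
    ∃ p : Fin (n + 1) → ℝ → ℝ,
      IsFTLSolution Vmax l ψ n w p0 p ∧
      (∀ t ∈ Set.Ici (0:ℝ), ∀ i : Fin n, l ≤ p i.succ t - p i.castSucc t) ∧
      ∀ q : Fin (n + 1) → ℝ → ℝ, IsFTLSolution Vmax l ψ n w p0 q →
        ∀ i : Fin (n + 1), ∀ t ∈ Set.Ici (0:ℝ), q i t = p i t := by
  obtain ⟨p, hp, hgap, huniq⟩ := exists_unique_isFTLSolution hVmax.le hl
    (hψ.of_le (by norm_num)) (fun ρ hρ => (hψmap ρ hρ).1) hψ1 n w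
    (fun i => hwmin.le.trans (hw i).1) p0 hp0
  exact ⟨p, hp, fun t ht => hgap t ht, fun q hq i t ht => huniq q hq i t ht⟩
end

section
/- Let f : [w_min, w_max] → (0,∞) be twice continuously differentiable and strictly monotone, and let g be a continuously differentiable function with g(f(w)) = w for all w ∈ [w_min, w_max]. Let Ω ⊆ ℝ² be open and let (ρ, w) : Ω → (0,R] × [w_min, w_max] be continuously differentiable and satisfy the quasilinear system ∂_t ρ + ∂_x(ρ w ψ(ρ)) = 0 and ∂_t w + w ψ(ρ) ∂_x w = 0 on Ω. Define η := ρ f(w). Then (ρ, η) satisfies, classically on Ω, the conservation-form system ∂_t ρ + ∂_x(ρ ψ(ρ) g(η/ρ)) = 0 and ∂_t η + ∂_x(η ψ(ρ) g(η/ρ)) = 0. -/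
open Set

/-- For classical solutions, the quasilinear system
`∂_t ρ + ∂_x (ρ w ψ(ρ)) = 0`, `∂_t w + w ψ(ρ) ∂_x w = 0` is equivalent, via
`η := ρ f(w)` with `f` strictly monotone and `g ∘ f = id`, to the conservation-form
system `∂_t ρ + ∂_x (ρ ψ(ρ) g(η/ρ)) = 0`, `∂_t η + ∂_x (η ψ(ρ) g(η/ρ)) = 0`. -/
theorem stmt_15 (R wmin wmax : ℝ)
    (hR : 0 < R) (hwmin : 0 < wmin) (hww : wmin < wmax)
    (ψ : ℝ → ℝ) (hψ : ContDiff ℝ 2 ψ)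
    (hψmap : ∀ ρ ∈ Set.Icc (0:ℝ) R, ψ ρ ∈ Set.Icc (0:ℝ) 1)
    (hψ0 : ψ 0 = 1) (hψR : ψ R = 0)
    (hψ' : ∀ ρ ∈ Set.Icc (0:ℝ) R, deriv ψ ρ ≤ 0)
    (hψconc : ∀ ρ ∈ Set.Icc (0:ℝ) R, deriv (deriv (fun r => r * ψ r)) ρ ≤ 0)
    (f : ℝ → ℝ) (hf : ContDiff ℝ 2 f)
    (hfpos : ∀ u ∈ Set.Icc wmin wmax, 0 < f u)
    (hfmono : StrictMonoOn f (Set.Icc wmin wmax) ∨ StrictAntiOn f (Set.Icc wmin wmax))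
    (g : ℝ → ℝ) (hg : ContDiff ℝ 1 g)
    (hgf : ∀ u ∈ Set.Icc wmin wmax, g (f u) = u)
    (Ω : Set (ℝ × ℝ)) (hΩ : IsOpen Ω)
    (ρ w : ℝ × ℝ → ℝ)
    (hρC1 : ContDiffOn ℝ 1 ρ Ω) (hwC1 : ContDiffOn ℝ 1 w Ω)
    (hρval : ∀ z ∈ Ω, ρ z ∈ Set.Ioc (0:ℝ) R)
    (hwval : ∀ z ∈ Ω, w z ∈ Set.Icc wmin wmax)
    (hpde1 : ∀ z ∈ Ω,
      fderiv ℝ ρ z (1, 0) + fderiv ℝ (fun y => ρ y * (w y * ψ (ρ y))) z (0, 1) = 0)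
    (hpde2 : ∀ z ∈ Ω,
      fderiv ℝ w z (1, 0) + w z * ψ (ρ z) * fderiv ℝ w z (0, 1) = 0) :
    ∀ z ∈ Ω,
      (fderiv ℝ ρ z (1, 0)
        + fderiv ℝ (fun y => ρ y * ψ (ρ y) * g (ρ y * f (w y) / ρ y)) z (0, 1) = 0)
      ∧
      (fderiv ℝ (fun y => ρ y * f (w y)) z (1, 0)
        + fderiv ℝ (fun y => ρ y * f (w y) * ψ (ρ y) * g (ρ y * f (w y) / ρ y)) z (0, 1)
          = 0) := by
  intro z hz
  have hnhds : Ω ∈ nhds z := hΩ.mem_nhds hz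
  have hρ : DifferentiableAt ℝ ρ z := (hρC1.contDiffAt hnhds).differentiableAt one_ne_zero
  have hw : DifferentiableAt ℝ w z := (hwC1.contDiffAt hnhds).differentiableAt one_ne_zero
  have hψρ : DifferentiableAt ℝ (fun y => ψ (ρ y)) z :=
    ((hψ.differentiable two_ne_zero) (ρ z)).comp z hρ
  have hfw : HasFDerivAt (fun y => f (w y)) (deriv f (w z) • fderiv ℝ w z) z :=
    ((hf.differentiable two_ne_zero) (w z)).hasDerivAt.comp_hasFDerivAt z hw.hasFDerivAt
  have hq : DifferentiableAt ℝ (fun y => ρ y * (w y * ψ (ρ y))) z := hρ.mul (hw.mul hψρ)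
  have hg_eq : ∀ y ∈ Ω, g (ρ y * f (w y) / ρ y) = w y := fun y hy => by
    rw [mul_div_cancel_left₀ _ (hρval y hy).1.ne', hgf _ (hwval y hy)]
  have hmass : (fun y => ρ y * ψ (ρ y) * g (ρ y * f (w y) / ρ y))
      =ᶠ[nhds z] fun y => ρ y * (w y * ψ (ρ y)) := by
    filter_upwards [hnhds] with y hy
    rw [hg_eq y hy]
    ring
  have hmomentum : (fun y => ρ y * f (w y) * ψ (ρ y) * g (ρ y * f (w y) / ρ y))
      =ᶠ[nhds z] fun y => f (w y) * (ρ y * (w y * ψ (ρ y))) := by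
    filter_upwards [hnhds] with y hy
    rw [hg_eq y hy]
    ring
  have h1 := hpde1 z hz
  have h2 := hpde2 z hz
  refine ⟨by rwa [hmass.fderiv_eq], ?_⟩
  rw [hmomentum.fderiv_eq, fderiv_fun_mul hfw.differentiableAt hq,
    fderiv_fun_mul hρ hfw.differentiableAt, hfw.fderiv]
  simp only [add_apply, smul_apply, smul_eq_mul]
  linear_combination f (w z) * h1 + ρ z * deriv f (w z) * h2
end
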